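/- Let λ be a nonzero real number, let r ≥ 1 and k ≥ r be integers, and let x be a real number with |x| < 1. Then the series Σ_{n=r}^∞ H^{(r)}_{n,λ} · binom(n,r) · r! · (n)_{k−r,λ} · x^n converges absolutely and equals −(log_λ(1−x)/(1−x)^r) · Σ_{l=r}^k S2_{r,λ}(k,l) · ⟨r−λ⟩_l · (x/(1−x))^l + (1/(1−x)^r) · Σ_{l=r}^k S2_{r,λ}(k,l) · l! · H^{(r)}_{l,λ} · (x/(1−x))^l, where log_λ(1−x) = ((1−x)^λ − 1)/λ. -/

import Mathlib

open Finset

/-- The degenerate falling factorial `(x)_{n,λ} = x(x-λ)⋯(x-(n-1)λ)`. -/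
noncomputable def degFall (lam x : ℝ) (n : ℕ) : ℝ := ∏ i ∈ Finset.range n, (x - (i : ℝ) * lam)

/-- The ordinary falling factorial `(x)_n = x(x-1)⋯(x-n+1)`. -/
noncomputable def fall (x : ℝ) (n : ℕ) : ℝ := ∏ i ∈ Finset.range n, (x - (i : ℝ))

/-- The rising factorial `⟨a⟩_k = a(a+1)⋯(a+k-1)`. -/
noncomputable def rising (a : ℝ) (k : ℕ) : ℝ := ∏ i ∈ Finset.range k, (a + (i : ℝ))

/-- The generalized binomial coefficient `binom(a,k) = a(a-1)⋯(a-k+1)/k!`. -/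
noncomputable def rchoose (a : ℝ) (k : ℕ) : ℝ :=
  (∏ i ∈ Finset.range k, (a - (i : ℝ))) / (k.factorial : ℝ)

/-- The degenerate harmonic numbers `H_{n,λ} = Σ_{k=1}^n (1/k)·binom(k-1-λ, k-1)`. -/
noncomputable def degH (lam : ℝ) (n : ℕ) : ℝ :=
  ∑ k ∈ Finset.Icc 1 n, (1 / (k : ℝ)) * rchoose ((k : ℝ) - 1 - lam) (k - 1)

/-- The degenerate hyperharmonic numbers `H^{(r)}_{n,λ}`. -/
noncomputable def degHyperH (lam : ℝ) : ℕ → ℕ → ℝ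
  | 0, _ => 0
  | 1, n => degH lam n
  | r + 2, n => ∑ k ∈ Finset.Icc 1 n, degHyperH lam (r + 1) k

/-- The degenerate harmonic-Fubini polynomial built from degenerate Stirling numbers `S2`. -/
noncomputable def HFpoly (lam : ℝ) (S2 : ℕ → ℕ → ℝ) (n : ℕ) (x : ℝ) : ℝ :=
  ∑ k ∈ Finset.Icc 1 n, S2 n k * degH lam k * (k.factorial : ℝ) * x ^ k

/-- The degenerate Fubini polynomial of order `1-λ` built from degenerate Stirling numbers `S2`. -/
noncomputable def Fpoly (lam : ℝ) (S2 : ℕ → ℕ → ℝ) (n : ℕ) (x : ℝ) : ℝ :=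
  ∑ k ∈ Finset.range (n + 1), rising (1 - lam) k * S2 n k * x ^ k

/-- The degenerate hyperharmonic-Fubini polynomial built from degenerate Stirling numbers `S2`. -/
noncomputable def HFpolyR (lam : ℝ) (S2 : ℕ → ℕ → ℝ) (r n : ℕ) (y : ℝ) : ℝ :=
  ∑ k ∈ Finset.Icc 1 n, S2 n k * degHyperH lam r k * (k.factorial : ℝ) * y ^ k

/-- The degenerate falling factorial power of the operator `θ = x·d/dx`:
`(θ)_{k,λ} = (θ - (k-1)λ) ∘ ⋯ ∘ (θ - λ) ∘ θ`. -/
noncomputable def thetaFall (lam : ℝ) : ℕ → (ℝ → ℝ) → ℝ → ℝ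
  | 0, g => g
  | k + 1, g => fun x => x * deriv (thetaFall lam k g) x - (k : ℝ) * lam * thetaFall lam k g x

lemma rising_succ (a : ℝ) (n : ℕ) : rising a (n + 1) = rising a n * (a + n) :=
  Finset.prod_range_succ _ _

lemma rising_succ_left (a : ℝ) (n : ℕ) : rising a (n + 1) = a * rising (a + 1) n := by
  unfold rising
  rw [Finset.prod_range_succ', mul_comm]
  congr 1
  · simp
  · refine Finset.prod_congr rfl fun i _ => ?_
    push_cast
    ring

lemma rising_add (a : ℝ) (l m : ℕ) : rising a (l + m) = rising a l * rising (a + l) m := by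
  unfold rising
  rw [Finset.prod_range_add]
  congr 1
  refine Finset.prod_congr rfl fun i _ => ?_
  push_cast
  ring

lemma sum_Icc_rising_div_factorial (a : ℝ) (n : ℕ) :
    ∑ k ∈ Finset.Icc 1 n, rising a k / (k.factorial : ℝ)
      = rising (a + 1) n / (n.factorial : ℝ) - 1 := by
  induction n with
  | zero => simp [rising]
  | succ n ih =>
    rw [Finset.sum_Icc_succ_top (by omega), ih, rising_succ_left a, rising_succ (a + 1),
      Nat.factorial_succ]
    have h := Nat.factorial_ne_zero n
    push_cast
    field_simp
    ring

lemma rchoose_eq_rising_div (lam : ℝ) (j : ℕ) :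
    rchoose ((j : ℝ) - lam) j = rising (1 - lam) j / (j.factorial : ℝ) := by
  unfold rchoose rising
  congr 1
  rw [← Finset.prod_range_reflect]
  refine Finset.prod_congr rfl fun i hi => ?_
  have hi := Finset.mem_range.mp hi
  rw [Nat.sub_sub, Nat.cast_sub (by omega)]
  push_cast
  ring

lemma rising_one (n : ℕ) : rising 1 n = (n.factorial : ℝ) := by
  induction n with
  | zero => simp [rising]
  | succ n ih =>
    rw [rising_succ, ih, Nat.factorial_succ]
    push_cast
    ring

lemma degH_eq {lam : ℝ} (hlam : lam ≠ 0) (n : ℕ) :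
    degH lam n = (rising 1 n - rising (1 - lam) n) / (lam * n.factorial) := by
  induction n with
  | zero => simp [degH, rising]
  | succ n ih =>
    have hd : degH lam (n + 1)
        = degH lam n + 1 / ((n : ℝ) + 1) * (rising (1 - lam) n / (n.factorial : ℝ)) := by
      rw [← rchoose_eq_rising_div]
      unfold degH
      rw [Finset.sum_Icc_succ_top (by omega)]
      simp
    rw [hd, ih, rising_succ, rising_succ, Nat.factorial_succ, rising_one]
    have h := Nat.factorial_ne_zero n
    push_cast
    field_simp
    ring

lemma degHyperH_succ_eq {lam : ℝ} (hlam : lam ≠ 0) (s n : ℕ) :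
    degHyperH lam (s + 1) n
      = (rising ((s : ℝ) + 1) n - rising ((s : ℝ) + 1 - lam) n) / (lam * n.factorial) := by
  induction s generalizing n with
  | zero => simpa [degHyperH] using degH_eq hlam n
  | succ s ih =>
    have h (k : ℕ) : degHyperH lam (s + 1) k = (rising ((s : ℝ) + 1) k / (k.factorial : ℝ)
        - rising ((s : ℝ) + 1 - lam) k / (k.factorial : ℝ)) / lam := by
      rw [ih]
      have := Nat.factorial_ne_zero k
      field_simp
    rw [degHyperH, Finset.sum_congr rfl fun k _ => h k, ← Finset.sum_div, Finset.sum_sub_distrib,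
      sum_Icc_rising_div_factorial, sum_Icc_rising_div_factorial]
    have hn := Nat.factorial_ne_zero n
    have e : (s : ℝ) + 1 - lam + 1 = (s : ℝ) + 1 + 1 - lam := by ring
    rw [e]
    push_cast
    field_simp
    ring

lemma degHyperH_eq {lam : ℝ} (hlam : lam ≠ 0) {r : ℕ} (hr : 1 ≤ r) (n : ℕ) :
    degHyperH lam r n = (rising (r : ℝ) n - rising ((r : ℝ) - lam) n) / (lam * n.factorial) := by
  obtain ⟨s, rfl⟩ := Nat.exists_eq_add_of_le' hr
  exact_mod_cast degHyperH_succ_eq hlam s n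

lemma ringChoose_eq_rising_div (b : ℝ) (m : ℕ) :
    Ring.choose (b + m - 1) m = rising b m / (m.factorial : ℝ) := by
  have h := Ring.factorial_nsmul_multichoose_eq_ascPochhammer b m
  rw [Polynomial.ascPochhammer_smeval_eq_eval] at h
  have hr : (ascPochhammer ℝ m).eval b = rising b m := by
    clear h
    induction m with
    | zero => simp [rising]
    | succ m ih => rw [ascPochhammer_succ_eval, ih, rising_succ]
  have hm : (m.factorial : ℝ) ≠ 0 := by exact_mod_cast Nat.factorial_ne_zero m
  rw [← Ring.multichoose_eq, eq_div_iff hm, ← hr, ← h, nsmul_eq_mul, mul_comm]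

lemma hasSum_rising_div_factorial_mul_pow (b : ℝ) {x : ℝ} (hx : |x| < 1) :
    HasSum (fun m : ℕ => rising b m / (m.factorial : ℝ) * x ^ m) ((1 - x) ^ (-b)) := by
  have hmem : x ∈ Metric.eball (0 : ℝ) 1 := by
    simpa [Metric.mem_eball, edist_zero_right, enorm_eq_nnnorm, ← NNReal.coe_lt_coe] using hx
  have h := (Real.one_div_one_sub_rpow_hasFPowerSeriesOnBall_zero b).hasSum hmem
  have h1 : 0 ≤ 1 - x := by linarith [(abs_lt.mp hx).2]
  simpa [ringChoose_eq_rising_div, Real.rpow_neg h1, FormalMultilinearSeries.ofScalars_apply_eq,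
    mul_comm] using h

lemma hasSum_rising_div_factorial_mul_descFactorial_mul_pow (a : ℝ) (l : ℕ) {x : ℝ}
    (hx : |x| < 1) :
    HasSum (fun n : ℕ => rising a n / (n.factorial : ℝ) * (n.descFactorial l : ℝ) * x ^ n)
      (rising a l * x ^ l * (1 - x) ^ (-(a + l))) := by
  have h0 : ∑ n ∈ Finset.range l,
      rising a n / (n.factorial : ℝ) * (n.descFactorial l : ℝ) * x ^ n = 0 :=
    Finset.sum_eq_zero fun n hn => by
      simp [Nat.descFactorial_of_lt (Finset.mem_range.mp hn)]
  rw [← hasSum_nat_add_iff' l, h0, sub_zero]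
  convert! (hasSum_rising_div_factorial_mul_pow (a + l) hx).mul_left (rising a l * x ^ l) using 2
    with m
  have hd : ((m.factorial : ℝ)) * ((m + l).descFactorial l : ℝ) = ((m + l).factorial : ℝ) := by
    have := Nat.factorial_mul_descFactorial (Nat.le_add_left l m)
    rw [Nat.add_sub_cancel] at this
    exact_mod_cast this
  have hm : (m.factorial : ℝ) ≠ 0 := by exact_mod_cast Nat.factorial_ne_zero m
  have hml : ((m + l).descFactorial l : ℝ) ≠ 0 := by
    exact_mod_cast (Nat.descFactorial_pos.mpr (Nat.le_add_left l m)).ne'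
  rw [← hd, show rising a (m + l) = _ from add_comm l m ▸ rising_add a l m, pow_add]
  field_simp

lemma fall_natCast (n j : ℕ) : fall (n : ℝ) j = (n.descFactorial j : ℝ) := by
  induction j with
  | zero => simp [fall]
  | succ j ih =>
    have h : fall (n : ℝ) (j + 1) = fall n j * ((n : ℝ) - j) := Finset.prod_range_succ _ _
    rw [h, ih, Nat.descFactorial_succ]
    rcases le_or_gt j n with hj | hj
    · rw [Nat.cast_mul, Nat.cast_sub hj, mul_comm]
    · simp [Nat.descFactorial_of_lt hj]

lemma choose_mul_factorial_mul_degFall {lam : ℝ} {r k : ℕ} {S : ℕ → ℝ}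
    (hS : ∀ z : ℝ, degFall lam (z + r) (k - r) = ∑ l ∈ Finset.Icc r k, S l * fall z (l - r))
    (n : ℕ) :
    (n.choose r : ℝ) * (r.factorial : ℝ) * degFall lam (n : ℝ) (k - r)
      = ∑ l ∈ Finset.Icc r k, S l * (n.descFactorial l : ℝ) := by
  have hc : (n.choose r : ℝ) * (r.factorial : ℝ) = (n.descFactorial r : ℝ) := by
    rw [Nat.descFactorial_eq_factorial_mul_choose]
    push_cast
    ring
  rw [hc]
  rcases lt_or_ge n r with hn | hn
  · rw [Nat.descFactorial_of_lt hn, Finset.sum_eq_zero]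
    · simp
    · intro l hl
      simp [Nat.descFactorial_of_lt (hn.trans_le (Finset.mem_Icc.mp hl).1)]
  · have h := hS ((n - r : ℕ) : ℝ)
    rw [← Nat.cast_add, Nat.sub_add_cancel hn] at h
    rw [h, Finset.mul_sum]
    refine Finset.sum_congr rfl fun l hl => ?_
    rw [fall_natCast, ← Nat.descFactorial_mul_descFactorial (Finset.mem_Icc.mp hl).1]
    push_cast
    ring

lemma hasSum_degHyperH_mul_descFactorial_mul_pow {lam : ℝ} (hlam : lam ≠ 0) {r : ℕ} (hr : 1 ≤ r)
    (l : ℕ) {x : ℝ} (hx : |x| < 1) :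
    HasSum (fun n : ℕ => degHyperH lam r n * (n.descFactorial l : ℝ) * x ^ n)
      (-((((1 - x) ^ lam - 1) / lam) / (1 - x) ^ r) *
          (rising ((r : ℝ) - lam) l * (x / (1 - x)) ^ l)
        + (1 / (1 - x) ^ r) * ((l.factorial : ℝ) * degHyperH lam r l * (x / (1 - x)) ^ l)) := by
  have h1 : 0 < 1 - x := by linarith [(abs_lt.mp hx).2]
  convert! ((hasSum_rising_div_factorial_mul_descFactorial_mul_pow (r : ℝ) l hx).sub
    (hasSum_rising_div_factorial_mul_descFactorial_mul_pow ((r : ℝ) - lam) l hx)).div_const lam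
    using 1
  · funext n
    rw [degHyperH_eq hlam hr]
    have hn := Nat.factorial_ne_zero n
    field_simp
  · have e1 : (1 - x) ^ (-((r : ℝ) + l)) = ((1 - x) ^ r * (1 - x) ^ l)⁻¹ := by
      rw [Real.rpow_neg h1.le, Real.rpow_add h1, Real.rpow_natCast, Real.rpow_natCast]
    have e2 : (1 - x) ^ (-((r : ℝ) - lam + l))
        = (1 - x) ^ lam * ((1 - x) ^ r * (1 - x) ^ l)⁻¹ := by
      rw [← e1, ← Real.rpow_add h1]
      congr 1
      ring
    have hl := Nat.factorial_ne_zero l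
    rw [e1, e2, degHyperH_eq hlam hr, div_pow]
    field_simp
    ring

theorem stmt16 (lam : ℝ) (hlam : lam ≠ 0) (r k : ℕ) (hr : 1 ≤ r) (hk : r ≤ k)
    (x : ℝ) (hx : |x| < 1)
    (S2r : ℕ → ℕ → ℝ)
    (hS2r : ∀ m : ℕ, r ≤ m → ∀ z : ℝ,
      degFall lam (z + r) (m - r) = ∑ l ∈ Finset.Icc r m, S2r m l * fall z (l - r)) :
    Summable (fun n : ℕ =>
      |degHyperH lam r n * (n.choose r : ℝ) * (r.factorial : ℝ) * degFall lam (n : ℝ) (k - r) *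
        x ^ n|) ∧
    ∑' n : ℕ, degHyperH lam r n * (n.choose r : ℝ) * (r.factorial : ℝ) *
        degFall lam (n : ℝ) (k - r) * x ^ n
      = -((((1 - x) ^ lam - 1) / lam) / (1 - x) ^ r) *
          ∑ l ∈ Finset.Icc r k, S2r k l * rising ((r : ℝ) - lam) l * (x / (1 - x)) ^ l
        + (1 / (1 - x) ^ r) *
          ∑ l ∈ Finset.Icc r k, S2r k l * (l.factorial : ℝ) * degHyperH lam r l *
            (x / (1 - x)) ^ l := by
  have hterm (n : ℕ) : degHyperH lam r n * (n.choose r : ℝ) * (r.factorial : ℝ) *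
      degFall lam (n : ℝ) (k - r) * x ^ n
        = ∑ l ∈ Finset.Icc r k, S2r k l * (degHyperH lam r n * (n.descFactorial l : ℝ) * x ^ n) := by
    have h := choose_mul_factorial_mul_degFall (hS2r k hk) n
    calc _ = degHyperH lam r n * x ^ n * ((n.choose r : ℝ) * (r.factorial : ℝ) *
          degFall lam (n : ℝ) (k - r)) := by ring
      _ = _ := by
        rw [h, Finset.mul_sum]
        exact Finset.sum_congr rfl fun l _ => by ring
  have hsum := hasSum_sum (s := Finset.Icc r k) fun l _ =>
    (hasSum_degHyperH_mul_descFactorial_mul_pow hlam hr l hx).mul_left (S2r k l)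
  simp_rw [← hterm] at hsum
  refine ⟨hsum.summable.abs, hsum.tsum_eq.trans ?_⟩
  rw [Finset.mul_sum, Finset.mul_sum, ← Finset.sum_add_distrib]
  exact Finset.sum_congr rfl fun l _ => by ring
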